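/- Rank-two Hall–Littlewood specialization (Corollary to Theorem 6.2): Consider the type B/C lattice model of rank 2 with partition λ = (λ₁ ≥ λ₂ ≥ 0) and bend weights Cᵢ = xᵢ⁻¹ and Bᵢ = q·xᵢ for i = 1, 2, and A₁, A₂, D₁, D₂ ∈ ℂ[q] satisfying A₁D₂ = 0 and A₂D₁ = q³ − q. Then Z_λ = (1/c_λ(q))·Σ_{w∈W} w( x₁^{λ₁}·x₂^{λ₂}·∏_{t∈T} (1−q·t)/(1−t) ), where T = { x₂/x₁, (x₁x₂)⁻¹, x₁⁻², x₂⁻² } and c_λ(q) = 1 if λ₁ > λ₂ and c_λ(q) = 1 + q if λ₁ = λ₂; that is, Z_λ is the type C Hall–Littlewood polynomial (zonal spherical function) indexed by λ. -/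

import Mathlib

noncomputable section

/-- Bosonic six-vertex Boltzmann weight `w_z(h_l, h_r, a, b)` (left horizontal label,
right horizontal label, top vertical multiplicity, bottom vertical multiplicity). -/
def sixw {F : Type} [Field F] (q z : F) : Bool → Bool → ℕ → ℕ → F
  | false, false, a, b => if a = b then 1 else 0
  | true,  true,  a, b => if a = b then z else 0
  | false, true,  a, b => if a = b + 1 then 1 - q ^ a else 0
  | true,  false, a, b => if b = a + 1 then z else 0

/-- Bend weight selector; the arguments are the left-boundary labels of the two rows
meeting the bend (top row of the pair first, bottom row second). -/
def bendw {F : Type} [Field F] (A B C D : F) : Bool → Bool → F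
  | false, false => A
  | true,  false => C
  | false, true  => B
  | true,  true  => D

/-- A state of the type B/C lattice model of rank `r` with bottom boundary given by the
partition `lam` and `L+1` columns: `m s c` is the multiplicity on the vertical edge
below row `s` (0-indexed from the bottom) in column `c`, and `h s c` is the occupancy of
the horizontal edge to the left of column `c` in row `s`. -/
structure BCState (r : ℕ) (lam : Fin r → ℕ) (L : ℕ) where
  m : Fin (2*r+1) → Fin (L+1) → ℕ
  h : Fin (2*r) → Fin (L+2) → Bool
  bottom : ∀ c : Fin (L+1), m 0 c = (Finset.univ.filter (fun i => lam i = c.val)).card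
  top : ∀ c : Fin (L+1), m (Fin.last (2*r)) c = 0
  right : ∀ s : Fin (2*r), h s (Fin.last (L+1)) = false

/-- The spectral parameter of row `s` (0-indexed from the bottom): row `2i-1` (1-indexed)
carries `xᵢ⁻¹` and row `2i` carries `xᵢ`. -/
def rowp {F : Type} [Field F] {r : ℕ} (x : Fin r → F) (s : Fin (2*r)) : F :=
  if s.val % 2 = 0 then (x ⟨s.val / 2, by have := s.isLt; omega⟩)⁻¹
  else x ⟨s.val / 2, by have := s.isLt; omega⟩

/-- The Boltzmann weight of a state: the product of the six-vertex weights at all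
tetravalent vertices times the product of the bend weights. -/
def stateWeight {F : Type} [Field F] {r : ℕ} {lam : Fin r → ℕ} {L : ℕ}
    (q : F) (x : Fin r → F) (A B C D : Fin r → F) (st : BCState r lam L) : F :=
  (∏ s : Fin (2*r), ∏ c : Fin (L+1),
      sixw q (rowp x s) (st.h s c.castSucc) (st.h s c.succ)
        (st.m s.succ c) (st.m s.castSucc c)) *
  ∏ i : Fin r,
      bendw (A i) (B i) (C i) (D i)
        (st.h ⟨2*i.val+1, by have := i.isLt; omega⟩ 0)
        (st.h ⟨2*i.val, by have := i.isLt; omega⟩ 0)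

/-- The partition function of the type B/C lattice model: the sum of the weights of all
states (only finitely many have nonzero weight). -/
def ZBC {F : Type} [Field F] {r : ℕ} (lam : Fin r → ℕ) (L : ℕ)
    (q : F) (x : Fin r → F) (A B C D : Fin r → F) : F :=
  ∑ᶠ st : BCState r lam L, stateWeight q x A B C D st

/-- `ℂ(q, x₁, x₂)`. -/
abbrev F2 : Type := FractionRing (MvPolynomial (Fin 3) ℂ)

/-- The element `q` of `ℂ(q, x₁, x₂)`. -/
def q2 : F2 := algebraMap (MvPolynomial (Fin 3) ℂ) F2 (MvPolynomial.X 0)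

/-- The elements `x₁, x₂` of `ℂ(q, x₁, x₂)`. -/
def x2v (i : Fin 2) : F2 :=
  algebraMap (MvPolynomial (Fin 3) ℂ) F2 (MvPolynomial.X i.succ)

/-- The embedding of the constants `ℂ`. -/
def cC2 : ℂ →+* F2 :=
  (algebraMap (MvPolynomial (Fin 3) ℂ) F2).comp MvPolynomial.C

/-- `a` lies in `ℂ[q] ⊆ ℂ(q, x₁, x₂)`. -/
def IsPolyQ2 (a : F2) : Prop :=
  ∃ p : Polynomial ℂ, a = Polynomial.eval₂ cC2 q2 p

/-- The sum `Σ_{w ∈ W} w(f)` over the hyperoctahedral group `W` of rank 2 (order 8),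
where `f` is given by the formula `g` evaluated at `(x₁, x₂)`: the action of `w` is by
permuting the variables and inverting a subset of them. -/
def WSum2 (g : (Fin 2 → F2) → F2) : F2 :=
  ∑ σ : Equiv.Perm (Fin 2), ∑ ε : Fin 2 → Bool,
    g fun i => if ε i then (x2v (σ i))⁻¹ else x2v (σ i)

/-- The product `∏_{t ∈ T} (1 − q·t)/(1 − t)` with
`T = {x₂/x₁, (x₁x₂)⁻¹, x₁⁻², x₂⁻²}`, evaluated at variables `y`. -/
def Tprod2 (y : Fin 2 → F2) : F2 :=
  ((1 - q2 * (y 1 / y 0)) / (1 - y 1 / y 0)) *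
  ((1 - q2 * (y 0 * y 1)⁻¹) / (1 - (y 0 * y 1)⁻¹)) *
  ((1 - q2 * (y 0 ^ 2)⁻¹) / (1 - (y 0 ^ 2)⁻¹)) *
  ((1 - q2 * (y 1 ^ 2)⁻¹) / (1 - (y 1 ^ 2)⁻¹))


abbrev S4 : Type := Fin (2*2) → Bool

def nxt (hl hr : Bool) (b : ℕ) : ℕ := b + hr.toNat - hl.toNat

def mcol (b : ℕ) (u v : S4) : Fin (2*2+1) → ℕ :=
  ![b, nxt (u 0) (v 0) b, nxt (u 1) (v 1) (nxt (u 0) (v 0) b),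
    nxt (u 2) (v 2) (nxt (u 1) (v 1) (nxt (u 0) (v 0) b)),
    nxt (u 3) (v 3) (nxt (u 2) (v 2) (nxt (u 1) (v 1) (nxt (u 0) (v 0) b)))]

lemma sixw_ne {F : Type} [Field F] {q z : F} {hl hr : Bool} {a b : ℕ}
    (h : sixw q z hl hr a b ≠ 0) : a = nxt hl hr b ∧ a + hl.toNat = b + hr.toNat := by
  cases hl <;> cases hr <;> simp [sixw, nxt] at h ⊢ <;> omega

lemma mcol_succ (b : ℕ) (u v : S4) (s : Fin (2*2)) :
    mcol b u v s.succ = nxt (u s) (v s) (mcol b u v s.castSucc) := by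
  fin_cases s <;> rfl

def colW {F : Type} [Field F] (q : F) (z : Fin (2*2) → F) (b : ℕ) (u v : S4) : F :=
  if mcol b u v (Fin.last (2*2)) = 0 then
    ∏ s : Fin (2*2), sixw q (z s) (u s) (v s) (mcol b u v s.succ) (mcol b u v s.castSucc)
  else 0

def cnt (u : S4) : ℕ := ∑ s, (u s).toNat

lemma colW_cnt {F : Type} [Field F] {q : F} {z : Fin (2*2) → F} {b : ℕ} {u v : S4}
    (h : colW q z b u v ≠ 0) : cnt u = cnt v + b := by
  unfold colW at h
  split_ifs at h with h0
  · rw [Finset.prod_ne_zero_iff] at h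
    have h' := fun s => (sixw_ne (h s (Finset.mem_univ s))).2
    have e0 := h' 0
    have e1 := h' 1
    have e2 := h' 2
    have e3 := h' 3
    have f0 : mcol b u v (Fin.castSucc 0) = b := rfl
    have f1 : mcol b u v (Fin.castSucc 1) = mcol b u v (Fin.succ 0) := rfl
    have f2 : mcol b u v (Fin.castSucc 2) = mcol b u v (Fin.succ 1) := rfl
    have f3 : mcol b u v (Fin.castSucc 3) = mcol b u v (Fin.succ 2) := rfl
    have f4 : mcol b u v (Fin.last (2*2)) = mcol b u v (Fin.succ 3) := rfl
    have c1 : cnt u = (u 0).toNat + (u 1).toNat + (u 2).toNat + (u 3).toNat :=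
      Fin.sum_univ_four _
    have c2 : cnt v = (v 0).toNat + (v 1).toNat + (v 2).toNat + (v 3).toNat :=
      Fin.sum_univ_four _
    omega
  · exact absurd rfl h

def bcnt {r : ℕ} (lam : Fin r → ℕ) (c : ℕ) : ℕ :=
  (Finset.univ.filter (fun i => lam i = c)).card

def bend4 {F : Type} [Field F] (A B C D : Fin 2 → F) (u : S4) : F :=
  ∏ i : Fin 2, bendw (A i) (B i) (C i) (D i)
        (u ⟨2*i.val+1, by have := i.isLt; omega⟩)
        (u ⟨2*i.val, by have := i.isLt; omega⟩)

def zeroS : S4 := fun _ => false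

def pathW {F : Type} [Field F] (lam : Fin 2 → ℕ) (L : ℕ) (q : F) (x : Fin 2 → F)
    (A B C D : Fin 2 → F) (g : Fin (L+2) → S4) : F :=
  bend4 A B C D (g 0) * ((∏ c : Fin (L+1), colW q (rowp x) (bcnt lam c.val) (g c.castSucc) (g c.succ))
    * (if g (Fin.last (L+1)) = zeroS then 1 else 0))

lemma st_m {F : Type} [Field F] {lam : Fin 2 → ℕ} {L : ℕ} {q : F} {x : Fin 2 → F}
    {A B C D : Fin 2 → F} (st : BCState 2 lam L) (h : stateWeight q x A B C D st ≠ 0)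
    (s : Fin (2*2+1)) (c : Fin (L+1)) :
    st.m s c = mcol (bcnt lam c.val) (fun s => st.h s c.castSucc) (fun s => st.h s c.succ) s := by
  have h1 := left_ne_zero_of_mul h
  rw [Finset.prod_ne_zero_iff] at h1
  have h2 : ∀ s : Fin (2*2), st.m s.succ c = nxt (st.h s c.castSucc) (st.h s c.succ) (st.m s.castSucc c) := by
    intro s
    have h3 := h1 s (Finset.mem_univ s)
    rw [Finset.prod_ne_zero_iff] at h3
    exact (sixw_ne (h3 c (Finset.mem_univ c))).1
  induction s using Fin.induction with
  | zero => exact st.bottom c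
  | succ s ih => rw [h2, mcol_succ, ih]

lemma st_weight {F : Type} [Field F] {lam : Fin 2 → ℕ} {L : ℕ} {q : F} {x : Fin 2 → F}
    {A B C D : Fin 2 → F} (st : BCState 2 lam L)
    (h : ∀ (s : Fin (2*2+1)) (c : Fin (L+1)),
    st.m s c = mcol (bcnt lam c.val) (fun s => st.h s c.castSucc) (fun s => st.h s c.succ) s) :
    stateWeight q x A B C D st = pathW lam L q x A B C D (fun c s => st.h s c) := by
  unfold stateWeight pathW
  rw [mul_comm]
  congr 1
  have hz : (fun s => st.h s (Fin.last (L+1))) = zeroS := funext fun s => st.right s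
  beta_reduce
  rw [if_pos hz, mul_one, Finset.prod_comm]
  refine Finset.prod_congr rfl fun c _ => ?_
  unfold colW
  rw [if_pos ((h _ c).symm.trans (st.top c))]
  refine Finset.prod_congr rfl fun s _ => ?_
  rw [h, h]

lemma ZBC_path {F : Type} [Field F] (lam : Fin 2 → ℕ) (L : ℕ) (q : F) (x : Fin 2 → F)
    (A B C D : Fin 2 → F) :
    ZBC lam L q x A B C D = ∑ g : Fin (L+2) → S4, pathW lam L q x A B C D g := by
  classical
  unfold ZBC
  rw [← finsum_eq_sum_of_fintype, ← finsum_mem_univ, ← finsum_mem_univ (f := pathW lam L q x A B C D),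
    ← finsum_mem_inter_support, ← finsum_mem_inter_support (pathW lam L q x A B C D)]
  refine finsum_mem_eq_of_bijOn (fun (st : BCState 2 lam L) c s => st.h s c) ⟨?_, ?_, ?_⟩ ?_
  · rintro st ⟨-, hst⟩
    refine ⟨trivial, ?_⟩
    rw [Function.mem_support] at hst ⊢
    rwa [← st_weight st (st_m st hst)]
  · rintro st ⟨-, hst⟩ st' ⟨-, hst'⟩ he
    have e1 : st.h = st'.h := by
      funext s c
      exact congrFun (congrFun he c) s
    have e2 : st.m = st'.m := by
      funext s c
      rw [st_m st hst, st_m st' hst', e1]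
    cases st; cases st'
    simp only at e1 e2
    subst e1 e2
    rfl
  · rintro g ⟨-, hg⟩
    rw [Function.mem_support] at hg
    have hg' := hg
    unfold pathW at hg
    have h1 := right_ne_zero_of_mul hg
    have h2 := left_ne_zero_of_mul h1
    have h3 := right_ne_zero_of_mul h1
    have h4 : g (Fin.last (L+1)) = zeroS := by
      by_contra h; simp [h] at h3
    rw [Finset.prod_ne_zero_iff] at h2
    have h5 : ∀ c : Fin (L+1), mcol (bcnt lam c.val) (g c.castSucc) (g c.succ) (Fin.last (2*2)) = 0 := by
      intro c
      by_contra h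
      have := h2 c (Finset.mem_univ c)
      unfold colW at this
      rw [if_neg h] at this
      exact this rfl
    let st : BCState 2 lam L :=
      { m := fun s c => mcol (bcnt lam c.val) (g c.castSucc) (g c.succ) s
        h := fun s c => g c s
        bottom := fun c => rfl
        top := h5
        right := fun s => congrFun h4 s }
    refine ⟨st, ⟨trivial, ?_⟩, rfl⟩
    rw [Function.mem_support, st_weight st (fun s c => rfl)]
    exact hg'
  · rintro st ⟨-, hst⟩
    exact st_weight st (st_m st hst)

def pvec {F : Type} [Field F] (T : ℕ → S4 → S4 → F) : ℕ → ℕ → S4 → F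
  | _, 0 => fun u => if u = zeroS then 1 else 0
  | c, n+1 => fun u => ∑ v, T c u v * pvec T (c+1) n v

lemma path_sum {F : Type} [Field F] (T : ℕ → S4 → S4 → F) (n : ℕ) : ∀ (c0 : ℕ) (φ : S4 → F),
    ∑ g : Fin (n+1) → S4, φ (g 0) * ((∏ c : Fin n, T (c0 + c.val) (g c.castSucc) (g c.succ))
      * (if g (Fin.last n) = zeroS then 1 else 0)) = ∑ u, φ u * pvec T c0 n u := by
  induction n with
  | zero =>
    intro c0 φ
    rw [← (Equiv.funUnique (Fin 1) S4).symm.sum_comp]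
    simp [pvec]
  | succ n ih =>
    intro c0 φ
    rw [← (Fin.consEquiv (fun _ : Fin (n+2) => S4)).sum_comp, Fintype.sum_prod_type]
    refine Finset.sum_congr rfl fun u _ => ?_
    have := ih (c0+1) (fun v => φ u * T c0 u v)
    have e : ∑ v, φ u * T c0 u v * pvec T (c0+1) n v = φ u * pvec T c0 (n+1) u := by
      simp only [pvec, Finset.mul_sum, mul_assoc]
    rw [← e, ← this]
    refine Finset.sum_congr rfl fun g _ => ?_
    rw [Fin.prod_univ_succ]
    simp only [Fin.consEquiv_apply, Fin.cons_zero, Fin.castSucc_zero, Fin.cons_succ, Fin.val_zero,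
      add_zero, Fin.val_succ, ← Fin.succ_last, ← Fin.succ_castSucc]
    simp only [mul_assoc, add_assoc, add_comm (1:ℕ)]

lemma ZBC_vec {F : Type} [Field F] (lam : Fin 2 → ℕ) (L : ℕ) (q : F) (x : Fin 2 → F)
    (A B C D : Fin 2 → F) :
    ZBC lam L q x A B C D = ∑ u, bend4 A B C D u *
      pvec (fun c => colW q (rowp x) (bcnt lam c)) 0 (L+1) u := by
  rw [ZBC_path, ← path_sum]
  refine Finset.sum_congr rfl fun g _ => ?_
  simp only [pathW, zero_add]

lemma sum16 {F : Type} [Field F] (f : S4 → F) :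
    ∑ u, f u = ∑ a : Bool, ∑ b : Bool, ∑ c : Bool, ∑ d : Bool, f ![a, b, c, d] := by
  let e : (Bool × Bool × Bool × Bool) ≃ S4 :=
    { toFun := fun p => ![p.1, p.2.1, p.2.2.1, p.2.2.2]
      invFun := fun u => (u 0, u 1, u 2, u 3)
      left_inv := fun p => rfl
      right_inv := fun u => by funext s; fin_cases s <;> rfl }
  rw [← e.sum_comp]
  simp only [Fintype.sum_prod_type]
  rfl

def colB {F : Type} [Field F] (q z0 z1 z2 z3 : F) (b : ℕ) (u0 u1 u2 u3 v0 v1 v2 v3 : Bool) : F :=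
  if nxt u3 v3 (nxt u2 v2 (nxt u1 v1 (nxt u0 v0 b))) = 0 then
    sixw q z0 u0 v0 (nxt u0 v0 b) b *
    sixw q z1 u1 v1 (nxt u1 v1 (nxt u0 v0 b)) (nxt u0 v0 b) *
    sixw q z2 u2 v2 (nxt u2 v2 (nxt u1 v1 (nxt u0 v0 b))) (nxt u1 v1 (nxt u0 v0 b)) *
    sixw q z3 u3 v3 (nxt u3 v3 (nxt u2 v2 (nxt u1 v1 (nxt u0 v0 b))))
      (nxt u2 v2 (nxt u1 v1 (nxt u0 v0 b)))
  else 0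

lemma colW_eq {F : Type} [Field F] (q : F) (z : Fin (2*2) → F) (b : ℕ) (u0 u1 u2 u3 v0 v1 v2 v3 : Bool) :
    colW q z b ![u0, u1, u2, u3] ![v0, v1, v2, v3] =
      colB q (z 0) (z 1) (z 2) (z 3) b u0 u1 u2 u3 v0 v1 v2 v3 := by
  unfold colW
  rw [show (∏ s : Fin (2*2), _) = _ from Fin.prod_univ_four _]
  rfl

def covB {F : Type} [Field F] (e12 e13 e14 e23 e24 : F) : Bool → Bool → Bool → Bool → F
  | true, true, false, false => e12
  | true, false, true, false => e13
  | true, false, false, true => e14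
  | false, true, true, false => e23
  | false, true, false, true => e24
  | _, _, _, _ => 0

/-- covector on the two-particle sector -/
def cov2 {F : Type} [Field F] (e12 e13 e14 e23 e24 : F) (u : S4) : F :=
  covB e12 e13 e14 e23 e24 (u 0) (u 1) (u 2) (u 3)

def covA {F : Type} [Field F] (g1 g2 g3 g4 : F) : Bool → Bool → Bool → Bool → F
  | true, false, false, false => g1
  | false, true, false, false => g2
  | false, false, true, false => g3
  | false, false, false, true => g4
  | _, _, _, _ => 0

/-- covector on the one-particle sector -/
def cov1 {F : Type} [Field F] (g1 g2 g3 g4 : F) (u : S4) : F :=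
  covA g1 g2 g3 g4 (u 0) (u 1) (u 2) (u 3)

lemma cov2_sum {F : Type} [Field F] (e12 e13 e14 e23 e24 : F) (f : S4 → F) :
    ∑ u, cov2 e12 e13 e14 e23 e24 u * f u =
      e12 * f ![true, true, false, false] + e13 * f ![true, false, true, false]
      + e14 * f ![true, false, false, true] + e23 * f ![false, true, true, false]
      + e24 * f ![false, true, false, true] := by
  rw [sum16]
  simp [cov2, covB]
  ring

lemma cov1_sum {F : Type} [Field F] (g1 g2 g3 g4 : F) (f : S4 → F) :
    ∑ u, cov1 g1 g2 g3 g4 u * f u =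
      g1 * f ![true, false, false, false] + g2 * f ![false, true, false, false]
      + g3 * f ![false, false, true, false] + g4 * f ![false, false, false, true] := by
  rw [sum16]
  simp [cov1, covA]
  ring

lemma forall16 {P : S4 → Prop} (h : ∀ a b c d : Bool, P ![a, b, c, d]) (u : S4) : P u := by
  have : u = ![u 0, u 1, u 2, u 3] := by funext s; fin_cases s <;> rfl
  rw [this]; exact h _ _ _ _

lemma cov2_K0 {F : Type} [Field F] (q : F) (z : Fin (2*2) → F) (e12 e13 e14 e23 e24 : F) (v : S4) :
    ∑ u, cov2 e12 e13 e14 e23 e24 u * colW q z 0 u v =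
      cov2 (e12 * (z 0 * z 1) + (1-q) * (e13 * (z 0 * z 2) + e14 * (z 0 * z 3)
              + e23 * (z 1 * z 2) + e24 * (z 1 * z 3)))
        (e13 * (z 0 * z 2) + (1-q) * (e14 * (z 0 * z 3) + e23 * (z 1 * z 2))
              + (1-q)^2 * e24 * (z 1 * z 3))
        (e14 * (z 0 * z 3) + (1-q) * e24 * (z 1 * z 3))
        (e23 * (z 1 * z 2) + (1-q) * e24 * (z 1 * z 3))
        (e24 * (z 1 * z 3)) v := by
  rw [cov2_sum]
  revert v
  refine forall16 ?_
  intro a b c d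
  simp only [colW_eq]
  cases a <;> cases b <;> cases c <;> cases d <;> simp [cov2, covB, colB, nxt, sixw] <;> ring

lemma cov2_K1 {F : Type} [Field F] (q : F) (z : Fin (2*2) → F) (e12 e13 e14 e23 e24 : F) (v : S4) :
    ∑ u, cov2 e12 e13 e14 e23 e24 u * colW q z 1 u v =
      cov1 (e12 * (z 0 * z 1) + e13 * (z 0 * z 2) + e14 * (z 0 * z 3)
              + (1-q^2) * (e23 * (z 1 * z 2) + e24 * (z 1 * z 3)))
        (e12 * (z 0 * z 1) + e23 * (z 1 * z 2) + e24 * (z 1 * z 3)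
          + (1-q) * (e13 * (z 0 * z 2) + e14 * (z 0 * z 3)))
        (e13 * (z 0 * z 2) + e23 * (z 1 * z 2) + (1-q) * (e14 * (z 0 * z 3) + e24 * (z 1 * z 3)))
        (e14 * (z 0 * z 3) + e24 * (z 1 * z 3)) v := by
  rw [cov2_sum]
  revert v
  refine forall16 ?_
  intro a b c d
  simp only [colW_eq]
  cases a <;> cases b <;> cases c <;> cases d <;> simp [cov1, covA, colB, nxt, sixw] <;> ring

lemma cov2_K2 {F : Type} [Field F] (q : F) (z : Fin (2*2) → F) (e12 e13 e14 e23 e24 : F) :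
    ∑ u, cov2 e12 e13 e14 e23 e24 u * colW q z 2 u zeroS =
      e12 * (z 0 * z 1) + e13 * (z 0 * z 2) + e14 * (z 0 * z 3)
              + e23 * (z 1 * z 2) + e24 * (z 1 * z 3) := by
  rw [cov2_sum]
  have : zeroS = ![false, false, false, false] := by funext s; fin_cases s <;> rfl
  rw [this]
  simp only [colW_eq]
  simp [colB, nxt, sixw]

lemma cov1_K0 {F : Type} [Field F] (q : F) (z : Fin (2*2) → F) (g1 g2 g3 g4 : F) (v : S4) :
    ∑ u, cov1 g1 g2 g3 g4 u * colW q z 0 u v =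
      cov1 (z 0 * g1 + (1-q) * (z 1 * g2 + z 2 * g3 + z 3 * g4))
        (z 1 * g2 + (1-q) * (z 2 * g3 + z 3 * g4))
        (z 2 * g3 + (1-q) * (z 3 * g4)) (z 3 * g4) v := by
  rw [cov1_sum]
  revert v
  refine forall16 ?_
  intro a b c d
  simp only [colW_eq]
  cases a <;> cases b <;> cases c <;> cases d <;> simp [cov1, covA, colB, nxt, sixw] <;> ring

lemma cov1_K1 {F : Type} [Field F] (q : F) (z : Fin (2*2) → F) (g1 g2 g3 g4 : F) :
    ∑ u, cov1 g1 g2 g3 g4 u * colW q z 1 u zeroS = z 0 * g1 + z 1 * g2 + z 2 * g3 + z 3 * g4 := by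
  rw [cov1_sum]
  have : zeroS = ![false, false, false, false] := by funext s; fin_cases s <;> rfl
  rw [this]
  simp only [colW_eq]
  simp [colB, nxt, sixw]
  ring

lemma bcnt_two (l1 l2 c : ℕ) :
    bcnt ![l1, l2] c = (if l1 = c then 1 else 0) + (if l2 = c then 1 else 0) := by
  unfold bcnt
  rw [Finset.card_filter, Fin.sum_univ_two]
  rfl

lemma pvec_cnt {F : Type} [Field F] (q : F) (z : Fin (2*2) → F) (b : ℕ → ℕ) (n : ℕ) : ∀ (c : ℕ) (u : S4),
    pvec (fun c => colW q z (b c)) c n u ≠ 0 → cnt u = ∑ i ∈ Finset.range n, b (c + i) := by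
  induction n with
  | zero =>
    intro c u h
    have : u = zeroS := by
      by_contra h'
      simp [pvec, h'] at h
    subst this
    simp [cnt, zeroS]
  | succ n ih =>
    intro c u h
    obtain ⟨v, -, hv⟩ := Finset.exists_ne_zero_of_sum_ne_zero h
    rw [colW_cnt (left_ne_zero_of_mul hv), ih _ _ (right_ne_zero_of_mul hv), Finset.sum_range_succ']
    simp only [add_zero, add_assoc, add_comm (1:ℕ)]

lemma pvec_eig {F : Type} [Field F] (q : F) (z : Fin (2*2) → F) (b : ℕ → ℕ) (E : S4 → F) (lam : F)
    (hE : ∀ v, ∑ u, E u * colW q z 0 u v = lam * E v) (n m : ℕ) : ∀ c : ℕ, (∀ i < m, b (c + i) = 0) →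
    ∑ u, E u * pvec (fun c => colW q z (b c)) c (m + n) u =
      lam ^ m * ∑ u, E u * pvec (fun c => colW q z (b c)) (c + m) n u := by
  induction m with
  | zero => intro c _; simp
  | succ m ih =>
    intro c hb
    have h0 : b c = 0 := hb 0 (Nat.succ_pos m)
    have := ih (c+1) (fun i hi => by
      have := hb (i+1) (by omega)
      rwa [show c + 1 + i = c + (i + 1) by omega])
    rw [show m + 1 + n = (m + n) + 1 by omega]
    simp only [pvec, h0, Finset.mul_sum]
    rw [Finset.sum_comm]
    simp only [← mul_assoc, ← Finset.sum_mul, hE]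
    simp only [mul_assoc, ← Finset.mul_sum]
    rw [this, show c + 1 + m = c + (m + 1) by omega, pow_succ]
    ring

lemma pvec_one {F : Type} [Field F] (T : ℕ → S4 → S4 → F) (c : ℕ) (u : S4) :
    pvec T c 1 u = T c u zeroS := by
  simp [pvec]

lemma pvec_step {F : Type} [Field F] (T : ℕ → S4 → S4 → F) (c n : ℕ) (E : S4 → F) :
    ∑ u, E u * pvec T c (n+1) u = ∑ v, (∑ u, E u * T c u v) * pvec T (c+1) n v := by
  simp only [pvec, Finset.mul_sum, Finset.sum_mul]
  rw [Finset.sum_comm]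
  simp only [mul_assoc]

lemma contrib1 {F : Type} [Field F] (q : F) (z : Fin (2*2) → F) (l1 l2 : ℕ) (hl : l2 < l1)
    (lam g1 g2 g3 g4 : F)
    (h4 : z 3 * g4 = lam * g4) (h3 : z 2 * g3 + (1-q) * (z 3 * g4) = lam * g3)
    (h2 : z 1 * g2 + (1-q) * (z 2 * g3 + z 3 * g4) = lam * g2)
    (h1 : z 0 * g1 + (1-q) * (z 1 * g2 + z 2 * g3 + z 3 * g4) = lam * g1) :
    ∑ u, cov1 g1 g2 g3 g4 u * pvec (fun c => colW q z (bcnt ![l1, l2] c)) (l2+1) (l1 - l2) u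
      = lam ^ (l1 - l2 - 1) * (z 0 * g1 + z 1 * g2 + z 2 * g3 + z 3 * g4) := by
  have hE : ∀ v, ∑ u, cov1 g1 g2 g3 g4 u * colW q z 0 u v = lam * cov1 g1 g2 g3 g4 v := by
    intro v
    rw [cov1_K0, h1, h2, h3, h4]
    simp only [cov1]
    cases v 0 <;> cases v 1 <;> cases v 2 <;> cases v 3 <;> simp [covA]
  have := pvec_eig q z (bcnt ![l1, l2]) _ lam hE 1 (l1 - l2 - 1) (l2+1) (fun i hi => by
    rw [bcnt_two, if_neg (by omega), if_neg (by omega)])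
  rw [show l1 - l2 - 1 + 1 = l1 - l2 by omega, show l2 + 1 + (l1 - l2 - 1) = l1 by omega] at this
  rw [this]
  simp only [pvec_one]
  rw [show bcnt ![l1, l2] l1 = 1 by rw [bcnt_two, if_pos rfl, if_neg (by omega)], cov1_K1]

lemma contrib2 {F : Type} [Field F] (q : F) (z : Fin (2*2) → F) (l1 l2 : ℕ) (hl : l2 ≤ l1)
    (lam e12 e13 e14 e23 e24 : F)
    (h24 : e24 * (z 1 * z 3) = lam * e24)
    (h23 : e23 * (z 1 * z 2) + (1-q) * e24 * (z 1 * z 3) = lam * e23)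
    (h14 : e14 * (z 0 * z 3) + (1-q) * e24 * (z 1 * z 3) = lam * e14)
    (h13 : e13 * (z 0 * z 2) + (1-q) * (e14 * (z 0 * z 3) + e23 * (z 1 * z 2))
              + (1-q)^2 * e24 * (z 1 * z 3) = lam * e13)
    (h12 : e12 * (z 0 * z 1) + (1-q) * (e13 * (z 0 * z 2) + e14 * (z 0 * z 3)
              + e23 * (z 1 * z 2) + e24 * (z 1 * z 3)) = lam * e12) :
    ∑ u, cov2 e12 e13 e14 e23 e24 u * pvec (fun c => colW q z (bcnt ![l1, l2] c)) 0 (l1+1) u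
      = lam ^ l2 * ∑ u, cov2 e12 e13 e14 e23 e24 u *
          pvec (fun c => colW q z (bcnt ![l1, l2] c)) l2 (l1 - l2 + 1) u := by
  have hE : ∀ v, ∑ u, cov2 e12 e13 e14 e23 e24 u * colW q z 0 u v =
      lam * cov2 e12 e13 e14 e23 e24 v := by
    intro v
    rw [cov2_K0, h12, h13, h14, h23, h24]
    simp only [cov2]
    cases v 0 <;> cases v 1 <;> cases v 2 <;> cases v 3 <;> simp [covB]
  have := pvec_eig q z (bcnt ![l1, l2]) _ lam hE (l1 - l2 + 1) l2 0 (fun i hi => by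
    rw [bcnt_two, if_neg (by omega), if_neg (by omega)])
  rw [show l2 + (l1 - l2 + 1) = l1 + 1 by omega, zero_add] at this
  exact this

section algebra
variable {F : Type} [Field F] (q x y : F)

def fP : F := (x^2 - q) / (x^2 - 1)
def fP' : F := (q * x^2 - 1) / (x^2 - 1)
def fR : F := (x - q * y) / (x - y)
def fR' : F := (q * x - y) / (x - y)
def fU : F := (x * y - q) / (x * y - 1)
def fU' : F := (q * (x * y) - 1) / (x * y - 1)

/-- row parameters -/
def zz : Fin (2*2) → F := ![x⁻¹, x, y⁻¹, y]

structure Good (x y : F) : Prop where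
  hx : x ≠ 0
  hy : y ≠ 0
  hx2 : x^2 - 1 ≠ 0
  hy2 : y^2 - 1 ≠ 0
  hxy : x - y ≠ 0
  hm : x * y - 1 ≠ 0

lemma zz0 : zz x y 0 = x⁻¹ := rfl
lemma zz1 : zz x y 1 = x := rfl
lemma zz2 : zz x y 2 = y⁻¹ := rfl
lemma zz3 : zz x y 3 = y := rfl

abbrev PV (l1 l2 : ℕ) : ℕ → ℕ → S4 → F := pvec (fun c => colW q (zz x y) (bcnt ![l1, l2] c))

variable {x y} (l1 l2 : ℕ)

lemma G1 (hg : Good x y) (c : F) (hl : l2 < l1) :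
    ∑ u, cov1 c 0 0 0 u * PV q x y l1 l2 (l2+1) (l1 - l2) u = (x⁻¹) ^ (l1 - l2) * c := by
  obtain ⟨hx, hy, hx2, hy2, hxy, hm⟩ := hg
  have hm' : y * x - 1 ≠ 0 := by rwa [mul_comm]
  rw [contrib1 q (zz x y) l1 l2 hl x⁻¹ c 0 0 0]
  · obtain ⟨n, hn⟩ : ∃ n, l1 - l2 = n + 1 := ⟨l1 - l2 - 1, by omega⟩
    rw [hn]; simp only [zz0, Nat.add_sub_cancel, pow_succ]; ring
  all_goals try simp only [zz0, zz1, zz2, zz3]; ring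

lemma G2 (hg : Good x y) (c : F) (hl : l2 < l1) :
    ∑ u, cov1 ((1-q) * c * x^2 / (x^2-1)) c 0 0 u * PV q x y l1 l2 (l2+1) (l1 - l2) u
      = x ^ (l1 - l2) * (c * fP q x) := by
  obtain ⟨hx, hy, hx2, hy2, hxy, hm⟩ := hg
  have hm' : y * x - 1 ≠ 0 := by rwa [mul_comm]
  rw [contrib1 q (zz x y) l1 l2 hl x]
  · obtain ⟨n, hn⟩ : ∃ n, l1 - l2 = n + 1 := ⟨l1 - l2 - 1, by omega⟩
    rw [hn]; simp only [zz0, zz1, fP, Nat.add_sub_cancel, pow_succ, mul_assoc]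
    congr 1
    field_simp
    ring
  all_goals
    try simp only [zz0, zz1, zz2, zz3]
    try field_simp
    try ring

lemma G3 (hg : Good x y) (c : F) (hl : l2 < l1) :
    ∑ u, cov1 ((1-q) * c * fU' q x y * x / (x-y)) (-((1-q) * c / (x*y-1))) c 0 u
        * PV q x y l1 l2 (l2+1) (l1 - l2) u
      = (y⁻¹) ^ (l1 - l2) * (c * fU' q x y * fR q x y) := by
  obtain ⟨hx, hy, hx2, hy2, hxy, hm⟩ := hg
  have hm' : y * x - 1 ≠ 0 := by rwa [mul_comm]
  rw [contrib1 q (zz x y) l1 l2 hl y⁻¹]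
  · obtain ⟨n, hn⟩ : ∃ n, l1 - l2 = n + 1 := ⟨l1 - l2 - 1, by omega⟩
    rw [hn]; simp only [zz0, zz1, zz2, zz3, fU', fR, Nat.add_sub_cancel, pow_succ, mul_assoc]
    congr 1
    field_simp
    ring
  all_goals
    try simp only [zz0, zz1, zz2, zz3, fU']
    try field_simp
    try ring

lemma G4 (hg : Good x y) (c : F) (hl : l2 < l1) :
    ∑ u, cov1 ((1-q) * y * c * fP q y * fR' q x y * x / (x*y-1)) (-((1-q) * y * c * fP q y / (x-y)))
        ((1-q) * c * y^2 / (y^2-1)) c u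
        * PV q x y l1 l2 (l2+1) (l1 - l2) u
      = y ^ (l1 - l2) * (c * fP q y * fR' q x y * fU q x y) := by
  obtain ⟨hx, hy, hx2, hy2, hxy, hm⟩ := hg
  have hm' : y * x - 1 ≠ 0 := by rwa [mul_comm]
  rw [contrib1 q (zz x y) l1 l2 hl y]
  · obtain ⟨n, hn⟩ : ∃ n, l1 - l2 = n + 1 := ⟨l1 - l2 - 1, by omega⟩
    rw [hn]; simp only [zz0, zz1, zz2, zz3, fP, fU, fR', Nat.add_sub_cancel, pow_succ, mul_assoc]
    congr 1
    field_simp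
    ring
  all_goals
    try simp only [zz0, zz1, zz2, zz3, fP, fR']
    try field_simp
    try ring

lemma cov1_add (a1 a2 a3 a4 b1 b2 b3 b4 : F) (u : S4) :
    cov1 (a1+b1) (a2+b2) (a3+b3) (a4+b4) u = cov1 a1 a2 a3 a4 u + cov1 b1 b2 b3 b4 u := by
  simp only [cov1]
  cases u 0 <;> cases u 1 <;> cases u 2 <;> cases u 3 <;> simp [covA]

/-- processing the column `l2` when `l2 < l1` -/
lemma col_lt (hl : l2 < l1) (e12 e13 e14 e23 e24 a1 a2 a3 a4 b1 b2 b3 b4 : F)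
    (h1 : e12 * (x⁻¹ * x) + e13 * (x⁻¹ * y⁻¹) + e14 * (x⁻¹ * y)
              + (1-q^2) * (e23 * (x * y⁻¹) + e24 * (x * y)) = a1 + b1)
    (h2 : e12 * (x⁻¹ * x) + e23 * (x * y⁻¹) + e24 * (x * y)
          + (1-q) * (e13 * (x⁻¹ * y⁻¹) + e14 * (x⁻¹ * y)) = a2 + b2)
    (h3 : e13 * (x⁻¹ * y⁻¹) + e23 * (x * y⁻¹) + (1-q) * (e14 * (x⁻¹ * y) + e24 * (x * y)) = a3 + b3)
    (h4 : e14 * (x⁻¹ * y) + e24 * (x * y) = a4 + b4) :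
    ∑ u, cov2 e12 e13 e14 e23 e24 u * PV q x y l1 l2 l2 (l1 - l2 + 1) u =
      ∑ u, cov1 a1 a2 a3 a4 u * PV q x y l1 l2 (l2+1) (l1 - l2) u +
      ∑ u, cov1 b1 b2 b3 b4 u * PV q x y l1 l2 (l2+1) (l1 - l2) u := by
  rw [pvec_step, ← Finset.sum_add_distrib]
  refine Finset.sum_congr rfl fun v _ => ?_
  rw [show bcnt ![l1, l2] l2 = 1 by rw [bcnt_two, if_neg (by omega), if_pos rfl], cov2_K1,
    ← add_mul, ← cov1_add, ← h1, ← h2, ← h3, ← h4]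
  rfl

/-- processing the column `l2` when `l2 = l1` -/
lemma col_eq (e12 e13 e14 e23 e24 : F) :
    ∑ u, cov2 e12 e13 e14 e23 e24 u * PV q x y l1 l1 l1 (l1 - l1 + 1) u =
      e12 * (x⁻¹ * x) + e13 * (x⁻¹ * y⁻¹) + e14 * (x⁻¹ * y) + e23 * (x * y⁻¹) + e24 * (x * y) := by
  rw [Nat.sub_self, zero_add]
  simp only [pvec_one]
  rw [show bcnt ![l1, l1] l1 = 2 by rw [bcnt_two, if_pos rfl], cov2_K2]
  rfl

/-- the right-hand side contribution of a pair -/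
def rhsP (q lam a b Ta Tb : F) (l1 l2 : ℕ) : F :=
  lam ^ l2 * ((1 / (if l1 = l2 then 1 + q else 1)) * (a ^ (l1 - l2) * Ta + b ^ (l1 - l2) * Tb))

lemma E24 (hg : Good x y) (hq : 1 + q ≠ 0) (hl : l2 ≤ l1) :
    ∑ u, cov2 ((1-q) * fP q x * fP q y / (x*y-1)) ((1-q)^2 * x * y / ((x^2-1)*(y^2-1)))
      ((1-q) * x / (y * (x^2-1))) ((1-q) * y / (x * (y^2-1))) (1/(x*y)) u
      * PV q x y l1 l2 0 (l1+1) u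
    = rhsP q (x*y) x y (fR q x y * fU q x y * fP q y * fP q x)
        (fP q x * fP q y * fR' q x y * fU q x y) l1 l2 := by
  have hg' := hg
  obtain ⟨hx, hy, hx2, hy2, hxy, hm⟩ := hg
  have hm' : y * x - 1 ≠ 0 := by rwa [mul_comm]
  rw [contrib2 q (zz x y) l1 l2 hl (x*y), rhsP]
  · congr 1
    rcases Nat.lt_or_eq_of_le hl with h | h
    · rw [if_neg (by omega), ← G2 q l1 l2 hg' _ h, ← G4 q l1 l2 hg' _ h, div_one, one_mul]
      apply col_lt q l1 l2 h
      all_goals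
        try simp only [fP, fR, fR', fU]
        try field_simp
        try ring
    · subst h
      rw [if_pos rfl, col_eq]
      simp only [fP, fR, fR', fU, Nat.sub_self, pow_zero]
      field_simp
      ring
  all_goals
    try simp only [zz0, zz1, zz2, zz3, fP]
    try field_simp
    try ring

lemma E14 (hg : Good x y) (hq : 1 + q ≠ 0) (hl : l2 ≤ l1) :
    ∑ u, cov2 (-((1-q) * fP' q x * fP q y * x / (x-y))) (fP' q x * (x/y) * (1-q) * y^2 / (y^2-1))
      (fP' q x * (x/y)) 0 0 u
      * PV q x y l1 l2 0 (l1+1) u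
    = rhsP q (x⁻¹*y) x⁻¹ y (fU' q x y * fR' q x y * fP' q x * fP q y)
        (fP' q x * fP q y * fR' q x y * fU q x y) l1 l2 := by
  have hg' := hg
  obtain ⟨hx, hy, hx2, hy2, hxy, hm⟩ := hg
  have hm' : y * x - 1 ≠ 0 := by rwa [mul_comm]
  rw [contrib2 q (zz x y) l1 l2 hl (x⁻¹*y), rhsP]
  · congr 1
    rcases Nat.lt_or_eq_of_le hl with h | h
    · rw [if_neg (by omega), ← G1 q l1 l2 hg' _ h, ← G4 q l1 l2 hg' _ h, div_one, one_mul]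
      apply col_lt q l1 l2 h
      all_goals
        try simp only [fP, fP', fR, fR', fU, fU']
        try field_simp
        try ring
    · subst h
      rw [if_pos rfl, col_eq]
      simp only [fP, fP', fR, fR', fU, fU', Nat.sub_self, pow_zero]
      field_simp
      ring
  all_goals
    try simp only [zz0, zz1, zz2, zz3, fP, fP']
    try field_simp
    try ring

lemma E23 (hg : Good x y) (hq : 1 + q ≠ 0) (hl : l2 ≤ l1) :
    ∑ u, cov2 ((1-q) * fP' q y * fP q x * y / (x-y)) (fP' q y * (y/x) * (1-q) * x^2 / (x^2-1))
      0 (fP' q y * (y/x)) 0 u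
      * PV q x y l1 l2 0 (l1+1) u
    = rhsP q (x*y⁻¹) x y⁻¹ (fU q x y * fR q x y * fP' q y * fP q x)
        (fP' q y * fP q x * fU' q x y * fR q x y) l1 l2 := by
  have hg' := hg
  obtain ⟨hx, hy, hx2, hy2, hxy, hm⟩ := hg
  have hm' : y * x - 1 ≠ 0 := by rwa [mul_comm]
  rw [contrib2 q (zz x y) l1 l2 hl (x*y⁻¹), rhsP]
  · congr 1
    rcases Nat.lt_or_eq_of_le hl with h | h
    · rw [if_neg (by omega), ← G2 q l1 l2 hg' _ h, ← G3 q l1 l2 hg' _ h, div_one, one_mul]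
      apply col_lt q l1 l2 h
      all_goals
        try simp only [fP, fP', fR, fR', fU, fU']
        try field_simp
        try ring
    · subst h
      rw [if_pos rfl, col_eq]
      simp only [fP, fP', fR, fR', fU, fU', Nat.sub_self, pow_zero]
      field_simp
      ring
  all_goals
    try simp only [zz0, zz1, zz2, zz3, fP, fP']
    try field_simp
    try ring

lemma E13 (hg : Good x y) (hq : 1 + q ≠ 0) (hl : l2 ≤ l1) :
    ∑ u, cov2 (-((1-q) * fP' q x * fP' q y * (x*y) / (x*y-1))) (fP' q x * fP' q y * (x*y))
      0 0 0 u
      * PV q x y l1 l2 0 (l1+1) u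
    = rhsP q (x⁻¹*y⁻¹) x⁻¹ y⁻¹ (fR' q x y * fU' q x y * fP' q x * fP' q y)
        (fP' q y * fP' q x * fU' q x y * fR q x y) l1 l2 := by
  have hg' := hg
  obtain ⟨hx, hy, hx2, hy2, hxy, hm⟩ := hg
  have hm' : y * x - 1 ≠ 0 := by rwa [mul_comm]
  rw [contrib2 q (zz x y) l1 l2 hl (x⁻¹*y⁻¹), rhsP]
  · congr 1
    rcases Nat.lt_or_eq_of_le hl with h | h
    · rw [if_neg (by omega), ← G1 q l1 l2 hg' _ h, ← G3 q l1 l2 hg' _ h, div_one, one_mul]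
      apply col_lt q l1 l2 h
      all_goals
        try simp only [fP, fP', fR, fR', fU, fU']
        try field_simp
        try ring
    · subst h
      rw [if_pos rfl, col_eq]
      simp only [fP, fP', fR, fR', fU, fU', Nat.sub_self, pow_zero]
      field_simp
      ring
  all_goals
    try simp only [zz0, zz1, zz2, zz3, fP, fP']
    try field_simp
    try ring

end algebra


section final

lemma fval {F : Type} [Field F] (q s a b : F) (h : s = a / b) (hb : b ≠ 0) :
    (1 - q * s) / (1 - s) = (b - q * a) / (b - a) := by
  subst h
  rw [show 1 - q * (a / b) = (b - q * a) / b by field_simp,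
    show 1 - a / b = (b - a) / b by field_simp, div_div_div_cancel_right₀ hb]

lemma fval' {F : Type} [Field F] (q s a b : F) (h : s = a / b) (hb : b ≠ 0) :
    (1 - q * s) / (1 - s) = (q * a - b) / (a - b) := by
  rw [fval q s a b h hb, ← neg_sub a b, ← neg_sub (q * a) b, neg_div_neg_eq]

/-- the product over `T` in a general field -/
def TG {F : Type} [Field F] (q a b : F) : F :=
  ((1 - q * (b / a)) / (1 - b / a)) *
  ((1 - q * (a * b)⁻¹) / (1 - (a * b)⁻¹)) *
  ((1 - q * (a ^ 2)⁻¹) / (1 - (a ^ 2)⁻¹)) *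
  ((1 - q * (b ^ 2)⁻¹) / (1 - (b ^ 2)⁻¹))

section fac
variable {F : Type} [Field F] (q : F) {x y s : F} (hx : x ≠ 0) (hy : y ≠ 0)

lemma sP (h : s = 1 / x^2) (hx : x ≠ 0) : (1 - q * s) / (1 - s) = fP q x := by
  rw [fval q s 1 (x^2) h (pow_ne_zero 2 hx), mul_one, fP]
lemma sP' (h : s = x^2 / 1) : (1 - q * s) / (1 - s) = fP' q x := by
  rw [fval' q s (x^2) 1 h one_ne_zero, fP']
lemma sR (h : s = y / x) (hx : x ≠ 0) : (1 - q * s) / (1 - s) = fR q x y := by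
  rw [fval q s y x h hx, fR]
lemma sR' (h : s = x / y) (hy : y ≠ 0) : (1 - q * s) / (1 - s) = fR' q x y := by
  rw [fval' q s x y h hy, fR']
lemma sU (h : s = 1 / (x * y)) (hx : x ≠ 0) (hy : y ≠ 0) : (1 - q * s) / (1 - s) = fU q x y := by
  rw [fval q s 1 (x*y) h (mul_ne_zero hx hy), mul_one, fU]
lemma sU' (h : s = x * y / 1) : (1 - q * s) / (1 - s) = fU' q x y := by
  rw [fval' q s (x*y) 1 h one_ne_zero, fU']
end fac

section tg
variable {F : Type} [Field F] (q : F) {x y : F} (hx : x ≠ 0) (hy : y ≠ 0)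

lemma TG1 (hx : x ≠ 0) (hy : y ≠ 0) : TG q x y = fR q x y * fU q x y * fP q x * fP q y := by
  rw [TG, sR q (x := x) (y := y) (by field_simp) hx, sU q (x := x) (y := y) (by field_simp) hx hy,
    sP q (x := x) (by field_simp) hx, sP q (x := y) (by field_simp) hy]
lemma TG2 (hx : x ≠ 0) (hy : y ≠ 0) : TG q x y⁻¹ = fU q x y * fR q x y * fP q x * fP' q y := by
  rw [TG, sU q (s := y⁻¹ / x) (x := x) (y := y) (by field_simp) hx hy,
    sR q (x := x) (y := y) (by field_simp) hx,
    sP q (x := x) (by field_simp) hx, sP' q (x := y) (by field_simp)]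
lemma TG3 (hx : x ≠ 0) (hy : y ≠ 0) : TG q x⁻¹ y = fU' q x y * fR' q x y * fP' q x * fP q y := by
  rw [TG, sU' q (s := y / x⁻¹) (x := x) (y := y) (by field_simp),
    sR' q (x := x) (y := y) (by field_simp) hy,
    sP' q (x := x) (by field_simp), sP q (x := y) (by field_simp) hy]
lemma TG4 (hx : x ≠ 0) (hy : y ≠ 0) : TG q x⁻¹ y⁻¹ = fR' q x y * fU' q x y * fP' q x * fP' q y := by
  rw [TG, sR' q (s := y⁻¹ / x⁻¹) (x := x) (y := y) (by field_simp) hy,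
    sU' q (x := x) (y := y) (by field_simp),
    sP' q (x := x) (by field_simp), sP' q (x := y) (by field_simp)]
lemma TG5 (hx : x ≠ 0) (hy : y ≠ 0) : TG q y x = fR' q x y * fU q x y * fP q y * fP q x := by
  rw [TG, sR' q (x := x) (y := y) (by field_simp) hy, sU q (x := x) (y := y) (by field_simp) hx hy,
    sP q (x := y) (by field_simp) hy, sP q (x := x) (by field_simp) hx]
lemma TG6 (hx : x ≠ 0) (hy : y ≠ 0) : TG q y x⁻¹ = fU q x y * fR' q x y * fP q y * fP' q x := by
  rw [TG, sU q (s := x⁻¹ / y) (x := x) (y := y) (by field_simp) hx hy,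
    sR' q (x := x) (y := y) (by field_simp) hy,
    sP q (x := y) (by field_simp) hy, sP' q (x := x) (by field_simp)]
lemma TG7 (hx : x ≠ 0) (hy : y ≠ 0) : TG q y⁻¹ x = fU' q x y * fR q x y * fP' q y * fP q x := by
  rw [TG, sU' q (s := x / y⁻¹) (x := x) (y := y) (by field_simp),
    sR q (x := x) (y := y) (by field_simp) hx,
    sP' q (x := y) (by field_simp), sP q (x := x) (by field_simp) hx]
lemma TG8 (hx : x ≠ 0) (hy : y ≠ 0) : TG q y⁻¹ x⁻¹ = fR q x y * fU' q x y * fP' q y * fP' q x := by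
  rw [TG, sR q (s := x⁻¹ / y⁻¹) (x := x) (y := y) (by field_simp) hx,
    sU' q (x := x) (y := y) (by field_simp),
    sP' q (x := y) (by field_simp), sP' q (x := x) (by field_simp)]
end tg

lemma bend_sum {F : Type} [Field F] (A B C D : Fin 2 → F) (V : S4 → F)
    (hV : ∀ u, V u ≠ 0 → cnt u = 2) (h1 : A 0 * D 1 = 0) :
    ∑ u, bend4 A B C D u * V u =
      ∑ u, cov2 (A 1 * D 0) (B 0 * B 1) (B 0 * C 1) (C 0 * B 1) (C 0 * C 1) u * V u := by
  refine Finset.sum_congr rfl fun u _ => ?_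
  by_cases hu : V u = 0
  · rw [hu, mul_zero, mul_zero]
  · have hc := hV u hu
    congr 1
    have c1 : cnt u = (u 0).toNat + (u 1).toNat + (u 2).toNat + (u 3).toNat :=
      Fin.sum_univ_four _
    have c2 : bend4 A B C D u = bendw (A 0) (B 0) (C 0) (D 0) (u 1) (u 0) *
        bendw (A 1) (B 1) (C 1) (D 1) (u 3) (u 2) := Fin.prod_univ_two _
    rw [c2, cov2]
    rw [c1] at hc
    revert hc
    cases u 0 <;> cases u 1 <;> cases u 2 <;> cases u 3 <;> simp [bendw, covB, h1, mul_comm]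

lemma cov2_add {F : Type} [Field F] (a1 a2 a3 a4 a5 b1 b2 b3 b4 b5 : F) (u : S4) :
    cov2 (a1+b1) (a2+b2) (a3+b3) (a4+b4) (a5+b5) u
      = cov2 a1 a2 a3 a4 a5 u + cov2 b1 b2 b3 b4 b5 u := by
  simp only [cov2]
  cases u 0 <;> cases u 1 <;> cases u 2 <;> cases u 3 <;> simp [covB]

lemma rhsP_eq {F : Type} [Field F] (q a b Ta Tb : F) (l1 l2 : ℕ) (hl : l2 ≤ l1) :
    rhsP q (a * b) a b Ta Tb l1 l2 = (1 / (if l1 = l2 then 1 + q else 1)) *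
      (a ^ l1 * b ^ l2 * Ta + b ^ l1 * a ^ l2 * Tb) := by
  obtain ⟨n, rfl⟩ := Nat.exists_eq_add_of_le hl
  rw [rhsP, Nat.add_sub_cancel_left]
  ring

lemma beta_eq {F : Type} [Field F] (q : F) {x y : F} (hg : Good x y) (l1 l2 : ℕ) (hl : l2 ≤ l1)
    (hq : 1 + q ≠ 0) :
    ∑ u, cov2 (q^3 - q) (q * x * (q * y)) (q * x * y⁻¹) (x⁻¹ * (q * y)) (x⁻¹ * y⁻¹) u
      * PV q x y l1 l2 0 (l1+1) u =
    (1 / (if l1 = l2 then 1 + q else 1)) *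
      (x ^ l1 * y ^ l2 * TG q x y + x ^ l1 * y⁻¹ ^ l2 * TG q x y⁻¹
       + x⁻¹ ^ l1 * y ^ l2 * TG q x⁻¹ y + x⁻¹ ^ l1 * y⁻¹ ^ l2 * TG q x⁻¹ y⁻¹
       + y ^ l1 * x ^ l2 * TG q y x + y ^ l1 * x⁻¹ ^ l2 * TG q y x⁻¹
       + y⁻¹ ^ l1 * x ^ l2 * TG q y⁻¹ x + y⁻¹ ^ l1 * x⁻¹ ^ l2 * TG q y⁻¹ x⁻¹) := by
  have e24 := E24 q l1 l2 hg hq hl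
  have e14 := E14 q l1 l2 hg hq hl
  have e23 := E23 q l1 l2 hg hq hl
  have e13 := E13 q l1 l2 hg hq hl
  have hx := hg.hx
  have hy := hg.hy
  rw [rhsP_eq _ _ _ _ _ _ _ hl] at e24 e14 e23 e13
  have key : ∀ u, cov2 (q^3 - q) (q * x * (q * y)) (q * x * y⁻¹) (x⁻¹ * (q * y)) (x⁻¹ * y⁻¹) u =
     cov2 ((1-q) * fP q x * fP q y / (x*y-1)) ((1-q)^2 * x * y / ((x^2-1)*(y^2-1)))
      ((1-q) * x / (y * (x^2-1))) ((1-q) * y / (x * (y^2-1))) (1/(x*y)) u +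
     cov2 (-((1-q) * fP' q x * fP q y * x / (x-y))) (fP' q x * (x/y) * (1-q) * y^2 / (y^2-1))
      (fP' q x * (x/y)) 0 0 u +
     cov2 ((1-q) * fP' q y * fP q x * y / (x-y)) (fP' q y * (y/x) * (1-q) * x^2 / (x^2-1))
      0 (fP' q y * (y/x)) 0 u +
     cov2 (-((1-q) * fP' q x * fP' q y * (x*y) / (x*y-1))) (fP' q x * fP' q y * (x*y))
      0 0 0 u := by
    intro u
    rw [← cov2_add, ← cov2_add, ← cov2_add]
    obtain ⟨hx, hy, hx2, hy2, hxy, hm⟩ := hg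
    have hm' : y * x - 1 ≠ 0 := by rwa [mul_comm]
    congr 1
    all_goals
      try simp only [fP, fP']
      field_simp
      try ring
  simp only [key, add_mul, Finset.sum_add_distrib]
  rw [e24, e14, e23, e13, TG1 q hx hy, TG2 q hx hy, TG3 q hx hy, TG4 q hx hy, TG5 q hx hy,
    TG6 q hx hy, TG7 q hx hy, TG8 q hx hy]
  ring

lemma sum_bcnt (l1 l2 : ℕ) (hl : l2 ≤ l1) :
    ∑ i ∈ Finset.range (l1+1), bcnt ![l1, l2] (0 + i) = 2 := by
  simp only [bcnt_two, zero_add, Finset.sum_add_distrib, Finset.sum_ite_eq, Finset.mem_range]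
  rw [if_pos (by omega), if_pos (by omega)]

/-- main identity over an arbitrary field -/
lemma main_gen {F : Type} [Field F] (q : F) (x : Fin 2 → F) (hg : Good (x 0) (x 1)) (l1 l2 : ℕ)
    (hl : l2 ≤ l1) (hq : 1 + q ≠ 0) (A D : Fin 2 → F)
    (h1 : A 0 * D 1 = 0) (h2 : A 1 * D 0 = q ^ 3 - q) :
    ZBC ![l1, l2] l1 q x A (fun i => q * x i) (fun i => (x i)⁻¹) D =
      (1 / (if l1 = l2 then 1 + q else 1)) *
      ∑ σ : Equiv.Perm (Fin 2), ∑ ε : Fin 2 → Bool,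
        (if ε 0 then (x (σ 0))⁻¹ else x (σ 0)) ^ l1 * (if ε 1 then (x (σ 1))⁻¹ else x (σ 1)) ^ l2 *
        TG q (if ε 0 then (x (σ 0))⁻¹ else x (σ 0)) (if ε 1 then (x (σ 1))⁻¹ else x (σ 1)) := by
  have hz : rowp x = zz (x 0) (x 1) := by
    funext s; fin_cases s <;> rfl
  rw [ZBC_vec, hz, bend_sum _ _ _ _ _ _ h1, h2, beta_eq q hg l1 l2 hl hq]
  · congr 1
    have hs : ∀ f : (Fin 2 → Bool) → F, ∑ ε, f ε =
        f ![false, false] + f ![false, true] + f ![true, false] + f ![true, true] := by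
      intro f
      rw [← (finTwoArrowEquiv Bool).symm.sum_comp, Fintype.sum_prod_type]
      simp [finTwoArrowEquiv]
      ring
    have hp : ∀ f : Equiv.Perm (Fin 2) → F, ∑ σ, f σ = f 1 + f (Equiv.swap 0 1) := by
      intro f
      rw [show (Finset.univ : Finset (Equiv.Perm (Fin 2))) = {1, Equiv.swap 0 1} by decide,
        Finset.sum_pair (by decide)]
    rw [hp, hs, hs]
    simp
    ring
  · intro u hu
    rw [pvec_cnt _ _ _ _ _ _ hu, sum_bcnt _ _ hl]

lemma ne_of_eval (p r : MvPolynomial (Fin 3) ℂ) (f : Fin 3 → ℂ)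
    (h : MvPolynomial.eval f p ≠ MvPolynomial.eval f r) :
    algebraMap (MvPolynomial (Fin 3) ℂ) F2 p ≠ algebraMap (MvPolynomial (Fin 3) ℂ) F2 r := by
  intro he
  exact h (congrArg _ (IsFractionRing.injective (MvPolynomial (Fin 3) ℂ) F2 he))

lemma good2 : Good (x2v 0) (x2v 1) := by
  have key : ∀ p : MvPolynomial (Fin 3) ℂ, MvPolynomial.eval ![2, 3, 5] p ≠ 0 →
      algebraMap (MvPolynomial (Fin 3) ℂ) F2 p ≠ 0 := by
    intro p hp
    have := ne_of_eval p 0 ![2, 3, 5] (by simpa using hp)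
    simpa using this
  constructor
  · exact key (MvPolynomial.X 1) (by simp)
  · exact key (MvPolynomial.X 2) (by simp)
  · have := key ((MvPolynomial.X 1)^2 - 1) (by simp; norm_num)
    rwa [map_sub, map_pow, map_one] at this
  · have := key ((MvPolynomial.X 2)^2 - 1) (by simp; norm_num)
    rwa [map_sub, map_pow, map_one] at this
  · have := key (MvPolynomial.X 1 - MvPolynomial.X 2) (by simp; norm_num)
    rwa [map_sub] at this
  · have := key (MvPolynomial.X 1 * MvPolynomial.X 2 - 1) (by simp; norm_num)
    rwa [map_sub, map_mul, map_one] at this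

lemma hq2 : 1 + q2 ≠ 0 := by
  have := ne_of_eval (1 + MvPolynomial.X 0) 0 ![2, 3, 5] (by simp; norm_num)
  rwa [map_add, map_one, map_zero] at this

end final

/-- Rank-two Hall–Littlewood specialization (Corollary to Theorem 6.2): with bend
weights `Cᵢ = xᵢ⁻¹`, `Bᵢ = q·xᵢ`, `A₁D₂ = 0` and `A₂D₁ = q³ − q`, the partition
function is the type C Hall–Littlewood polynomial indexed by `λ`. -/
theorem stmt13 (l1 l2 : ℕ) (hl : l2 ≤ l1) (A D : Fin 2 → F2)
    (hA : ∀ i, IsPolyQ2 (A i)) (hD : ∀ i, IsPolyQ2 (D i))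
    (h1 : A 0 * D 1 = 0) (h2 : A 1 * D 0 = q2 ^ 3 - q2) :
    ZBC ![l1, l2] l1 q2 x2v A (fun i => q2 * x2v i) (fun i => (x2v i)⁻¹) D
      = (1 / (if l1 = l2 then 1 + q2 else 1)) *
          WSum2 (fun y => y 0 ^ l1 * y 1 ^ l2 * Tprod2 y) := by
  exact main_gen q2 x2v good2 l1 l2 hl hq2 A D h1 h2
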